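/- Let X be a Hausdorff space, λ an infinite cardinal, and set κ = skL(X, 2^{ψ(X)·λ}) · ψ(X) · λ. Then |X| ≤ nw_θ(X)^κ. -/

import Mathlib

open Cardinal Set

universe u

/-- Skew-λ Lindelöf degree of `A` in `X`. -/
noncomputable def skLrel (X : Type u) [TopologicalSpace X] (A : Set X) (lam : Cardinal.{u}) :
    Cardinal.{u} :=
  sInf {κ : Cardinal.{u} | ℵ₀ ≤ κ ∧
    ∀ 𝒰 : Set (Set X), (∀ U ∈ 𝒰, IsOpen U) → A ⊆ ⋃₀ 𝒰 →
      ∃ 𝒱 ⊆ 𝒰, #↥𝒱 ≤ κ ∧ #↥(A \ ⋃₀ 𝒱) < lam}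

/-- Skew-λ Lindelöf degree of `X`. -/
noncomputable def skL (X : Type u) [TopologicalSpace X] (lam : Cardinal.{u}) : Cardinal.{u} :=
  skLrel X Set.univ lam

/-- Lindelöf degree of `X`. -/
noncomputable def Ldeg (X : Type u) [TopologicalSpace X] : Cardinal.{u} :=
  sInf {κ : Cardinal.{u} | ℵ₀ ≤ κ ∧
    ∀ 𝒰 : Set (Set X), (∀ U ∈ 𝒰, IsOpen U) → ⋃₀ 𝒰 = Set.univ →
      ∃ 𝒱 ⊆ 𝒰, #↥𝒱 ≤ κ ∧ ⋃₀ 𝒱 = Set.univ}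

/-- Pseudocharacter of `X`. -/
noncomputable def psi (X : Type u) [TopologicalSpace X] : Cardinal.{u} :=
  sInf {κ : Cardinal.{u} | ℵ₀ ≤ κ ∧
    ∀ x : X, ∃ 𝒱 : Set (Set X), (∀ V ∈ 𝒱, IsOpen V) ∧ #↥𝒱 ≤ κ ∧ ⋂₀ 𝒱 = {x}}

/-- Closed pseudocharacter of `X`. -/
noncomputable def psic (X : Type u) [TopologicalSpace X] : Cardinal.{u} :=
  sInf {κ : Cardinal.{u} | ℵ₀ ≤ κ ∧
    ∀ x : X, ∃ 𝒱 : Set (Set X), (∀ V ∈ 𝒱, IsOpen V ∧ x ∈ V) ∧ #↥𝒱 ≤ κ ∧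
      (⋂ V ∈ 𝒱, closure V) = {x}}

/-- Tightness of `X`. -/
noncomputable def tight (X : Type u) [TopologicalSpace X] : Cardinal.{u} :=
  sInf {κ : Cardinal.{u} | ℵ₀ ≤ κ ∧
    ∀ (A : Set X) (x : X), x ∈ closure A → ∃ B ⊆ A, #↥B ≤ κ ∧ x ∈ closure B}

/-- Character of `X`. -/
noncomputable def charDeg (X : Type u) [TopologicalSpace X] : Cardinal.{u} :=
  sInf {κ : Cardinal.{u} | ℵ₀ ≤ κ ∧
    ∀ x : X, ∃ ℬ : Set (Set X), (∀ B ∈ ℬ, IsOpen B ∧ x ∈ B) ∧ #↥ℬ ≤ κ ∧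
      ∀ U : Set X, IsOpen U → x ∈ U → ∃ B ∈ ℬ, B ⊆ U}

/-- Density of `X`. -/
noncomputable def dens (X : Type u) [TopologicalSpace X] : Cardinal.{u} :=
  sInf {κ : Cardinal.{u} | ℵ₀ ≤ κ ∧ ∃ D : Set X, Dense D ∧ #↥D ≤ κ}

/-- θ-network weight of `X`. -/
noncomputable def nwTheta (X : Type u) [TopologicalSpace X] : Cardinal.{u} :=
  sInf {κ : Cardinal.{u} | ℵ₀ ≤ κ ∧
    ∃ 𝒩 : Set (Set X), 𝒩.Nonempty ∧ #↥𝒩 ≤ κ ∧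
      ∀ (x : X) (U : Set X), IsOpen U → x ∈ U → ∃ N ∈ 𝒩, x ∈ N ∧ N ⊆ closure U}

/-- Skew-λ almost Lindelöf degree of `A` in `X`. -/
noncomputable def saLrel (X : Type u) [TopologicalSpace X] (A : Set X) (lam : Cardinal.{u}) :
    Cardinal.{u} :=
  sInf {κ : Cardinal.{u} | ℵ₀ ≤ κ ∧
    ∀ 𝒰 : Set (Set X), (∀ U ∈ 𝒰, IsOpen U) → A ⊆ ⋃₀ 𝒰 →
      ∃ 𝒱 ⊆ 𝒰, #↥𝒱 ≤ κ ∧ #↥(A \ ⋃ V ∈ 𝒱, closure V) < lam}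

/-- Skew-λ almost Lindelöf degree of `X`. -/
noncomputable def saL (X : Type u) [TopologicalSpace X] (lam : Cardinal.{u}) : Cardinal.{u} :=
  saLrel X Set.univ lam

/-- Skew-λ almost Lindelöf degree of `X` with respect to closed sets. -/
noncomputable def saLc (X : Type u) [TopologicalSpace X] (lam : Cardinal.{u}) : Cardinal.{u} :=
  sSup {c : Cardinal.{u} | ∃ A : Set X, IsClosed A ∧ c = saLrel X A lam}

/-- κ-closure of a set. -/
def clk {X : Type u} [TopologicalSpace X] (κ : Cardinal.{u}) (A : Set X) : Set X :=
  ⋃ B ∈ {B : Set X | B ⊆ A ∧ #↥B ≤ κ}, closure B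

/-- Skew-λ almost Lindelöf degree of `X` with respect to κ-closed sets. -/
noncomputable def saLk (X : Type u) [TopologicalSpace X] (κ lam : Cardinal.{u}) : Cardinal.{u} :=
  sSup {c : Cardinal.{u} | ∃ A : Set X, clk κ A = A ∧ c = saLrel X A lam}

/-- Skew-λ weak Lindelöf degree of `A` in `X`. -/
noncomputable def swLrel (X : Type u) [TopologicalSpace X] (A : Set X) (lam : Cardinal.{u}) :
    Cardinal.{u} :=
  sInf {κ : Cardinal.{u} | ℵ₀ ≤ κ ∧
    ∀ 𝒰 : Set (Set X), (∀ U ∈ 𝒰, IsOpen U) → A ⊆ ⋃₀ 𝒰 →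
      ∃ 𝒱 ⊆ 𝒰, #↥𝒱 ≤ κ ∧ #↥(A \ closure (⋃₀ 𝒱)) < lam}

/-- Skew-λ weak Lindelöf degree of `X`. -/
noncomputable def swL (X : Type u) [TopologicalSpace X] (lam : Cardinal.{u}) : Cardinal.{u} :=
  swLrel X Set.univ lam

/-- Skew-λ weak Lindelöf degree of `X` with respect to closed sets. -/
noncomputable def swLc (X : Type u) [TopologicalSpace X] (lam : Cardinal.{u}) : Cardinal.{u} :=
  sSup {c : Cardinal.{u} | ∃ A : Set X, IsClosed A ∧ c = swLrel X A lam}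

theorem psi_spec (X : Type u) [TopologicalSpace X] [T2Space X] : ℵ₀ ≤ psi X ∧
    ∀ x : X, ∃ 𝒱 : Set (Set X), (∀ V ∈ 𝒱, IsOpen V) ∧ #↥𝒱 ≤ psi X ∧ ⋂₀ 𝒱 = {x} := by
  have h := csInf_mem (s := {κ : Cardinal.{u} | ℵ₀ ≤ κ ∧
    ∀ x : X, ∃ 𝒱 : Set (Set X), (∀ V ∈ 𝒱, IsOpen V) ∧ #↥𝒱 ≤ κ ∧ ⋂₀ 𝒱 = {x}}) ?_
  · exact h
  · refine ⟨max ℵ₀ #(Set X), le_max_left _ _, fun x => ⟨{V | ∃ y, y ≠ x ∧ V = {y}ᶜ}, ?_, ?_, ?_⟩⟩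
    · rintro V ⟨y, -, rfl⟩
      exact isOpen_compl_singleton
    · exact (mk_set_le _).trans (le_max_right _ _)
    · ext z
      simp only [mem_sInter, mem_ofPred_eq, mem_singleton_iff]
      constructor
      · intro hz
        by_contra hne
        exact hz _ ⟨z, hne, rfl⟩ rfl
      · rintro rfl V ⟨y, hy, rfl⟩
        exact fun h => hy h.symm

theorem skL_spec (X : Type u) [TopologicalSpace X] (lam : Cardinal.{u}) (hl : 0 < lam) :
    ℵ₀ ≤ skL X lam ∧ ∀ 𝒰 : Set (Set X), (∀ U ∈ 𝒰, IsOpen U) → Set.univ ⊆ ⋃₀ 𝒰 →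
      ∃ 𝒱 ⊆ 𝒰, #↥𝒱 ≤ skL X lam ∧ #↥((Set.univ : Set X) \ ⋃₀ 𝒱) < lam := by
  have h := csInf_mem (s := {κ : Cardinal.{u} | ℵ₀ ≤ κ ∧
    ∀ 𝒰 : Set (Set X), (∀ U ∈ 𝒰, IsOpen U) → Set.univ ⊆ ⋃₀ 𝒰 →
      ∃ 𝒱 ⊆ 𝒰, #↥𝒱 ≤ κ ∧ #↥((Set.univ : Set X) \ ⋃₀ 𝒱) < lam}) ?_
  · exact h
  · refine ⟨max ℵ₀ #(Set X), le_max_left _ _, fun 𝒰 _ hc => ⟨𝒰, subset_rfl, ?_, ?_⟩⟩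
    · exact (mk_set_le _).trans (le_max_right _ _)
    · rw [sdiff_eq_empty.2 hc]
      simpa using hl

theorem nwTheta_spec (X : Type u) [TopologicalSpace X] : ℵ₀ ≤ nwTheta X ∧
    ∃ 𝒩 : Set (Set X), 𝒩.Nonempty ∧ #↥𝒩 ≤ nwTheta X ∧
      ∀ (x : X) (U : Set X), IsOpen U → x ∈ U → ∃ N ∈ 𝒩, x ∈ N ∧ N ⊆ closure U := by
  have h := csInf_mem (s := {κ : Cardinal.{u} | ℵ₀ ≤ κ ∧
    ∃ 𝒩 : Set (Set X), 𝒩.Nonempty ∧ #↥𝒩 ≤ κ ∧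
      ∀ (x : X) (U : Set X), IsOpen U → x ∈ U → ∃ N ∈ 𝒩, x ∈ N ∧ N ⊆ closure U}) ?_
  · exact h
  · exact ⟨max ℵ₀ #(Set X), le_max_left _ _, Set.univ, ⟨∅, trivial⟩,
      (mk_set_le _).trans (le_max_right _ _), fun x U _ hx => ⟨U, trivial, hx, subset_closure⟩⟩

/-- Every point lies in an intersection of few network elements which is small. -/
theorem key {X : Type u} [TopologicalSpace X] [T2Space X] {κ μ p s : Cardinal.{u}}
    (hκ : ℵ₀ ≤ κ) (hp : p ≤ κ) (hs : s ≤ κ) (hμ : μ ≤ 2 ^ κ) (𝒩 : Set (Set X))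
    (hN : ∀ (x : X) (U : Set X), IsOpen U → x ∈ U → ∃ N ∈ 𝒩, x ∈ N ∧ N ⊆ closure U)
    (hS : ∀ 𝒰 : Set (Set X), (∀ U ∈ 𝒰, IsOpen U) → Set.univ ⊆ ⋃₀ 𝒰 →
      ∃ 𝒱 ⊆ 𝒰, #↥𝒱 ≤ s ∧ #↥((Set.univ : Set X) \ ⋃₀ 𝒱) < μ)
    (x : X) (𝒲 : Set (Set X)) (hWo : ∀ V ∈ 𝒲, IsOpen V) (hWc : #↥𝒲 ≤ p) (hW : ⋂₀ 𝒲 = {x}) :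
    ∃ 𝒮 : Set 𝒩, #𝒮 ≤ κ ∧ x ∈ (⋂ N ∈ 𝒮, (N : Set X)) ∧
      #↥(⋂ N ∈ 𝒮, (N : Set X)) ≤ 2 ^ κ := by
  let 𝒢 : Set (Set X) := {U | IsOpen U ∧ ∃ N : 𝒩, x ∈ (N : Set X) ∧ Disjoint (N : Set X) U}
  have hcov : ∀ y, y ≠ x → ∃ U ∈ 𝒢, y ∈ U := by
    intro y hy
    obtain ⟨A, B, hA, hB, hxA, hyB, hAB⟩ := t2_separation hy.symm
    obtain ⟨N, hN1, hxN, hNA⟩ := hN x A hA hxA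
    exact ⟨B, ⟨hB, ⟨N, hN1⟩, hxN, (hAB.closure_left hB).mono_left hNA⟩, hyB⟩
  have hch : ∀ U : 𝒢, ∃ N : 𝒩, x ∈ (N : Set X) ∧ Disjoint (N : Set X) U := fun U => U.2.2
  choose f hf1 hf2 using hch
  have h1 : ∀ V : 𝒲, ∃ 𝒱 ⊆ insert (V : Set X) 𝒢, #↥𝒱 ≤ s ∧
      #↥((Set.univ : Set X) \ ⋃₀ 𝒱) < μ := by
    intro V
    apply hS
    · rintro U (rfl | hU)
      · exact hWo _ V.2
      · exact hU.1
    · intro z _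
      by_cases hz : z = x
      · refine ⟨V, Or.inl rfl, ?_⟩
        have : x ∈ ⋂₀ 𝒲 := by rw [hW]; rfl
        rw [hz]
        exact this _ V.2
      · obtain ⟨U, hU, hzU⟩ := hcov z hz
        exact ⟨U, Or.inr hU, hzU⟩
  choose v hv1 hv2 hv3 using h1
  let T : 𝒲 → Set 𝒩 := fun V => f '' {U : 𝒢 | (U : Set X) ∈ v V}
  have hT : ∀ V, #(T V) ≤ κ := by
    intro V
    refine mk_image_le.trans (le_trans ?_ ((hv2 V).trans hs))
    exact mk_preimage_of_injective _ _ Subtype.val_injective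
  refine ⟨⋃ V, T V, ?_, ?_, ?_⟩
  · refine (mk_iUnion_le _).trans ?_
    refine (mul_le_mul' (hWc.trans hp) (ciSup_le' hT)).trans ?_
    exact (mul_eq_self hκ).le
  · simp only [mem_iInter, mem_iUnion]
    rintro N ⟨V, U, hU, rfl⟩
    exact hf1 U
  · have hsub : (⋂ N ∈ (⋃ V, T V), (N : Set X)) ⊆ {x} ∪ ⋃ V : 𝒲, (Set.univ \ ⋃₀ (v V)) := by
      intro z hz
      simp only [mem_iInter, mem_iUnion] at hz
      by_cases hzx : z = x
      · exact Or.inl hzx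
      right
      have : z ∉ ⋂₀ 𝒲 := by rw [hW]; exact hzx
      simp only [mem_sInter, not_forall] at this
      obtain ⟨V, hV, hzV⟩ := this
      refine mem_iUnion.2 ⟨⟨V, hV⟩, trivial, ?_⟩
      rintro ⟨U, hU, hzU⟩
      rcases hv1 ⟨V, hV⟩ hU with rfl | hUG
      · exact hzV hzU
      · exact disjoint_left.1 (hf2 ⟨U, hUG⟩) (hz _ ⟨⟨V, hV⟩, ⟨U, hUG⟩, hU, rfl⟩) hzU
    have h2 : ℵ₀ ≤ 2 ^ κ := hκ.trans (cantor κ).le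
    refine (mk_le_mk_of_subset hsub).trans ((mk_union_le _ _).trans ?_)
    refine add_le_of_le h2 ?_ ?_
    · rw [mk_singleton]
      exact one_le_aleph0.trans h2
    · refine (mk_iUnion_le _).trans ?_
      refine (mul_le_mul' ((hWc.trans hp).trans (cantor κ).le)
        (ciSup_le' fun V => (hv3 V).le.trans hμ)).trans ?_
      exact (mul_eq_self h2).le

/-- Lemma 3.5: for κ = skL(X,2^{ψ(X)·λ})·ψ(X)·λ, |X| ≤ nw_θ(X)^κ. -/
theorem lemmaB {X : Type u} [TopologicalSpace X] [T2Space X]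
    (lam : Cardinal.{u}) (hlam : ℵ₀ ≤ lam) :
    #X ≤ nwTheta X ^ (skL X (2 ^ (psi X * lam)) * psi X * lam) := by
  obtain ⟨hψ, hψ2⟩ := psi_spec X
  obtain ⟨hs, hs2⟩ := skL_spec X (2 ^ (psi X * lam))
    (lt_of_le_of_lt zero_le (cantor _))
  obtain ⟨hn, 𝒩, -, hNc, hN⟩ := nwTheta_spec X
  generalize skL X (2 ^ (psi X * lam)) = s at *
  generalize psi X = p at *
  generalize nwTheta X = ν at *
  have s0 : s ≠ 0 := (aleph0_pos.trans_le hs).ne'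
  have p0 : p ≠ 0 := (aleph0_pos.trans_le hψ).ne'
  have l0 : lam ≠ 0 := (aleph0_pos.trans_le hlam).ne'
  have hsκ : s ≤ s * p * lam := (le_mul_right p0).trans (le_mul_right l0)
  have hpκ : p ≤ s * p * lam := (le_mul_left s0).trans (le_mul_right l0)
  have hμ : (2 : Cardinal) ^ (p * lam) ≤ 2 ^ (s * p * lam) := by
    refine power_le_power_left two_ne_zero ?_
    rw [mul_assoc]
    exact le_mul_left s0
  generalize s * p * lam = κ at *
  have hκ : ℵ₀ ≤ κ := hs.trans hsκ
  have hk : ∀ x : X, ∃ 𝒮 : Set 𝒩, #𝒮 ≤ κ ∧ x ∈ (⋂ N ∈ 𝒮, (N : Set X)) ∧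
      #↥(⋂ N ∈ 𝒮, (N : Set X)) ≤ 2 ^ κ := by
    intro x
    obtain ⟨𝒲, h1, h2, h3⟩ := hψ2 x
    exact key hκ hpκ hsκ hμ 𝒩 hN hs2 x 𝒲 h1 h2 h3
  choose S hS1 hS2 hS3 using hk
  let I := {t : Set 𝒩 // #t ≤ κ}
  have hI : #I ≤ ν ^ κ := by
    refine (mk_bounded_set_le _ _).trans ?_
    exact power_le_power_right (max_le hNc hn)
  have h2ν : (2 : Cardinal) ^ κ ≤ ν ^ κ :=
    power_le_power_right ((natCast_le_aleph0 (n := 2)).trans hn)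
  have hνκ : ℵ₀ ≤ ν ^ κ := (hκ.trans (cantor κ).le).trans h2ν
  have hfib : ∀ i : I, #((fun x => (⟨S x, hS1 x⟩ : I)) ⁻¹' {i}) ≤ ν ^ κ := by
    intro i
    by_cases hi : ∃ x, (⟨S x, hS1 x⟩ : I) = i
    · obtain ⟨x, rfl⟩ := hi
      refine le_trans (mk_le_mk_of_subset ?_) ((hS3 x).trans h2ν)
      intro y hy
      have : S y = S x := congrArg Subtype.val hy
      rw [← this]
      exact hS2 y
    · have : ((fun x => (⟨S x, hS1 x⟩ : I)) ⁻¹' {i}) = ∅ := by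
        ext y
        simp only [mem_preimage, mem_singleton_iff, mem_empty_iff_false, iff_false]
        exact fun h => hi ⟨y, h⟩
      rw [this]
      simp
  have hU : (Set.univ : Set X) ⊆ ⋃ i : I, ((fun x => (⟨S x, hS1 x⟩ : I)) ⁻¹' {i}) :=
    fun x _ => mem_iUnion.2 ⟨_, rfl⟩
  rw [← mk_univ]
  refine (mk_le_mk_of_subset hU).trans ((mk_iUnion_le _).trans ?_)
  exact (mul_le_mul' hI (ciSup_le' hfib)).trans (mul_eq_self hνκ).le
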